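/- Let G be a countable group, M ⊆ G a finite subset, A a finite set, and S = A^(A^M). Let s, t ∈ S^G and suppose σ_t ∘ σ_s = Id. Then σ_s is stably injective, and moreover, for every p ∈ Σ(s) there exists q ∈ Σ(t) such that σ_q ∘ σ_p = Id. -/

import Mathlib

open Pointwise

section ANUCA

variable {G : Type*} [Group G] {A : Type*}

/-- The shift action of `G` on configurations: `(g · x) h = x (g⁻¹ * h)`. -/
def shiftC {S : Type*} (g : G) (x : G → S) : G → S := fun h => x (g⁻¹ * h)

/-- The prodiscrete topology on `G → S` (product topology, `S` discrete). -/
def prodiscrete (G S : Type*) : TopologicalSpace (G → S) :=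
  @Pi.topologicalSpace G (fun _ => S) (fun _ => ⊥)

/-- `Σ(s)`: the closure of the shift orbit of `s` in the prodiscrete topology. -/
def orbitClosure {S : Type*} (s : G → S) : Set (G → S) :=
  @closure _ (prodiscrete G S) {p | ∃ g : G, shiftC g s = p}

/-- The ANUCA `σ_s` with memory `M` associated with the configuration of local
defining maps `s : G → (A^M → A)`, namely `σ_s x g = s g ((g⁻¹ · x)|_M)`. -/
def anuca (M : Set G) (s : G → ((M → A) → A)) (x : G → A) : G → A :=
  fun g => s g (fun m => x (g * (m : G)))

/-- `σ_s` is stably injective if `σ_p` is injective for every `p ∈ Σ(s)`. -/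
def StablyInjective (M : Set G) (s : G → ((M → A) → A)) : Prop :=
  ∀ p ∈ orbitClosure s, Function.Injective (anuca M p)

/-- `σ_s` is reversible if `σ_w ∘ σ_s = Id` for some ANUCA `σ_w` with finite memory. -/
def Reversible (M : Set G) (s : G → ((M → A) → A)) : Prop :=
  ∃ N : Set G, N.Finite ∧ ∃ w : G → ((N → A) → A), anuca N w ∘ anuca M s = id

/-- `σ_s` is stably reversible if there are a finite `N ⊆ G` and `q ∈ T^G`,
`T = A^(A^N)`, such that every `p ∈ Σ(s)` admits `w ∈ Σ(q)` with `σ_w ∘ σ_p = Id`. -/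
def StablyReversible (M : Set G) (s : G → ((M → A) → A)) : Prop :=
  ∃ N : Set G, N.Finite ∧ ∃ q : G → ((N → A) → A),
    ∀ p ∈ orbitClosure s, ∃ w ∈ orbitClosure q, anuca N w ∘ anuca M p = id

/-- `σ_s` is invertible if it is bijective and its inverse is an ANUCA with finite memory. -/
def InvertibleANUCA (M : Set G) (s : G → ((M → A) → A)) : Prop :=
  Function.Bijective (anuca M s) ∧
    ∃ N : Set G, N.Finite ∧ ∃ w : G → ((N → A) → A),
      anuca N w ∘ anuca M s = id ∧ anuca M s ∘ anuca N w = id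

/-- Two configurations are asymptotic if they agree outside a finite set. -/
def Asymptotic {S : Type*} (x y : G → S) : Prop := {g : G | x g ≠ y g}.Finite

/-- A map `τ : A^G → A^G` is pre-injective if it is injective on asymptotic pairs. -/
def PreInjective (τ : (G → A) → (G → A)) : Prop :=
  ∀ x y : G → A, Asymptotic x y → τ x = τ y → x = y

/-- A map `τ : A^G → A^G` is post-surjective if every configuration asymptotic to
`τ x` is the image of a configuration asymptotic to `x`. -/
def PostSurjective (τ : (G → A) → (G → A)) : Prop :=
  ∀ x y : G → A, Asymptotic y (τ x) → ∃ z : G → A, Asymptotic z x ∧ τ z = y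

end ANUCA


/-- A configuration lies in `Σ(s)` iff it is a pointwise limit of shifts of `s` along some
ultrafilter on `G`. -/
theorem mem_orbitClosure_iff_exists_ultrafilter {G S : Type*} [Group G] {s p : G → S} :
    p ∈ orbitClosure s ↔
      ∃ U : Ultrafilter G, ∀ k : G, ∀ᶠ g in (U : Filter G), shiftC g s k = p k := by
  let _ : TopologicalSpace S := ⊥
  have : DiscreteTopology S := ⟨rfl⟩
  have tendsto_iff : ∀ U : Ultrafilter G,
      Filter.Tendsto (fun g => shiftC g s) U (nhds p) ↔
        ∀ k : G, ∀ᶠ g in (U : Filter G), shiftC g s k = p k := fun U => by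
    simp only [tendsto_pi_nhds, nhds_discrete, Filter.tendsto_pure]
  simp only [← tendsto_iff]
  change p ∈ closure (Set.range fun g => shiftC g s) ↔ _
  constructor
  · intro hp
    have : (Filter.comap (fun g => shiftC g s) (nhds p)).NeBot :=
      Filter.comap_neBot_iff.mpr fun V hV => by
        obtain ⟨_, hV', g, rfl⟩ := mem_closure_iff_nhds.mp hp V hV
        exact ⟨g, hV'⟩
    exact ⟨Ultrafilter.of _, Filter.tendsto_iff_comap.mpr (Ultrafilter.of_le _)⟩
  · rintro ⟨U, hU⟩
    exact mem_closure_of_tendsto hU (Filter.Eventually.of_forall Set.mem_range_self)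

/-- Every family of points of a finite type is eventually constant along an ultrafilter. -/
theorem Ultrafilter.exists_eventually_eq_of_finite {ι S : Type*} [Finite S] (U : Ultrafilter ι)
    (f : ι → S) : ∃ c, ∀ᶠ i in (U : Filter ι), f i = c := by
  obtain ⟨c, hc⟩ := Ultrafilter.eq_pure_of_finite (U.map f)
  refine ⟨c, ?_⟩
  have : ({c} : Set S) ∈ U.map f := by rw [hc]; exact Set.mem_singleton c
  exact this

theorem anuca_shiftC {G A : Type*} [Group G] (M : Set G) (g : G) (s : G → ((M → A) → A))
    (x : G → A) : anuca M (shiftC g s) (shiftC g x) = shiftC g (anuca M s x) := by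
  funext k
  simp only [anuca, shiftC, mul_assoc]

theorem shiftC_shiftC_inv {G S : Type*} [Group G] (g : G) (x : G → S) :
    shiftC g (shiftC g⁻¹ x) = x := by
  funext k
  simp [shiftC]

theorem anuca_shiftC_comp_eq_id {G A : Type*} [Group G] {M : Set G} {s t : G → ((M → A) → A)}
    (h : anuca M t ∘ anuca M s = id) (g : G) :
    anuca M (shiftC g t) ∘ anuca M (shiftC g s) = id := by
  funext x
  have hx : anuca M t (anuca M s (shiftC g⁻¹ x)) = shiftC g⁻¹ x := congrFun h _
  rw [Function.comp_apply, ← shiftC_shiftC_inv g x, anuca_shiftC, anuca_shiftC, hx, id]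

/-- A left inverse of `σ_s` by an ANUCA `σ_t` passes to limits of shifts. -/
theorem exists_mem_orbitClosure_anuca_comp_eq_id {G A : Type*} [Group G] [Finite A]
    {M : Set G} (hM : M.Finite) {s t : G → ((M → A) → A)}
    (h : anuca M t ∘ anuca M s = id) {p : G → ((M → A) → A)} (hp : p ∈ orbitClosure s) :
    ∃ q ∈ orbitClosure t, anuca M q ∘ anuca M p = id := by
  have : Finite M := hM.to_subtype
  obtain ⟨U, hU⟩ := mem_orbitClosure_iff_exists_ultrafilter.mp hp
  choose q hq using fun k => U.exists_eventually_eq_of_finite fun g => shiftC g t k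
  refine ⟨q, mem_orbitClosure_iff_exists_ultrafilter.mpr ⟨U, hq⟩, ?_⟩
  funext x k
  have hs : ∀ᶠ g in (U : Filter G), ∀ m : M, shiftC g s (k * m) = p (k * m) :=
    Filter.eventually_all.mpr fun m => hU _
  obtain ⟨g, hgs, hgt⟩ := (hs.and (hq k)).exists
  have hx := congrFun (congrFun (anuca_shiftC_comp_eq_id h g) x) k
  simpa only [Function.comp_apply, anuca, hgs, hgt] using hx

/-- If `σ_t ∘ σ_s = Id` then `σ_s` is stably injective, and every `p ∈ Σ(s)` admits
`q ∈ Σ(t)` with `σ_q ∘ σ_p = Id`. -/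
theorem stmt17 {G A : Type*} [Group G] [Countable G] [Finite A]
    (M : Set G) (hM : M.Finite) (s t : G → ((M → A) → A))
    (h : anuca M t ∘ anuca M s = id) :
    StablyInjective M s ∧
      ∀ p ∈ orbitClosure s, ∃ q ∈ orbitClosure t, anuca M q ∘ anuca M p = id := by
  have left_inv : ∀ p ∈ orbitClosure s, ∃ q ∈ orbitClosure t, anuca M q ∘ anuca M p = id :=
    fun _ hp => exists_mem_orbitClosure_anuca_comp_eq_id hM h hp
  refine ⟨fun p hp => ?_, left_inv⟩
  obtain ⟨q, -, hq⟩ := left_inv p hp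
  exact (Function.leftInverse_iff_comp.mpr hq).injective
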